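/- Charge counting via the smeared electric field: Let d ≥ 2, m > 0, 0 < η ≤ 1 and R ≥ 3; write K_s = [−s,s]^d. Let Λ ⊂ ℝ^d be a finite set, N : Λ → {1,2,3,…}, and let h ∈ C¹(Ω) where Ω is an open set containing K_{R+2}, satisfying for every φ ∈ C_c^∞(int K_{R+2}): ∫ ∇h·∇φ = c_d ( Σ_{p∈Λ} N_p ∫ ρ_η(x−p) φ(x) dx − m ∫ φ ). Then there is C > 0 depending only on d such that: Σ_{p∈Λ∩K_{R−2}} N_p ≤ m (2R)^d + C R^{(d−1)/2} ‖∇h‖_{L²(K_R)}, and Σ_{p∈Λ∩K_{R+1}} N_p ≥ m (2(R−1))^d − C R^{(d−1)/2} ‖∇h‖_{L²(K_R)}. -/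

import Mathlib

open MeasureTheory Metric Real Filter
open scoped Topology ENNReal BigOperators RealInnerProductSpace Classical

noncomputable section

/-- Euclidean space `ℝ^d`. -/
abbrev Euc (d : ℕ) := EuclideanSpace ℝ (Fin d)

/-- The constant `c_d`: `2π` for `d = 2` and `(d−2)|S^{d−1}|` for `d ≥ 3`
(using `|S^{d-1}| = d · |B(0,1)|`). -/
def cConst (d : ℕ) : ℝ :=
  if d = 2 then 2 * π
  else ((d : ℝ) - 2) * d * (volume (ball (0 : Euc d) 1)).toReal

/-- The smeared Dirac mass `δ_p^{(η)}`: density `ρ_η(x - p)` with `ρ_η(x) = η^{-d} ρ(x/η)`. -/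
def smear (d : ℕ) (ρ : Euc d → ℝ) (η : ℝ) (p : Euc d) (x : Euc d) : ℝ :=
  (η ^ d)⁻¹ * ρ (η⁻¹ • (x - p))

/-- The hypercube `K_s = [−s, s]^d`. -/
def Kcube (d : ℕ) (s : ℝ) : Set (Euc d) := {z : Euc d | ∀ i, z i ∈ Set.Icc (-s) s}

/-! ### Cubes -/

lemma Kcube_eq_preimage (d : ℕ) (s : ℝ) :
    Kcube d s = (WithLp.ofLp : Euc d → (Fin d → ℝ)) ⁻¹'
      Set.Icc (fun _ => -s) (fun _ => s) := by
  ext z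
  simp only [Kcube, Set.mem_ofPred_eq, Set.mem_Icc, Set.mem_preimage, Pi.le_def]
  exact forall_and

lemma isCompact_Kcube (d : ℕ) (s : ℝ) : IsCompact (Kcube d s) := by
  rw [Kcube_eq_preimage]
  exact (PiLp.homeomorph 2 (fun _ : Fin d => ℝ)).isCompact_preimage.2 isCompact_Icc

lemma volume_real_Kcube (d : ℕ) {s : ℝ} (hs : 0 ≤ s) :
    (volume : Measure (Euc d)).real (Kcube d s) = (2 * s) ^ d := by
  rw [Kcube_eq_preimage, measureReal_def,
    (PiLp.volume_preserving_ofLp (Fin d)).measure_preimage measurableSet_Icc.nullMeasurableSet,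
    Real.volume_Icc_pi_toReal (fun _ => by linarith)]
  simp only [Finset.prod_const, Finset.card_univ, Fintype.card_fin]
  ring

lemma Kcube_mono (d : ℕ) {s t : ℝ} (hst : s ≤ t) : Kcube d s ⊆ Kcube d t :=
  fun _ hz i => ⟨by linarith [(hz i).1], (hz i).2.trans hst⟩

lemma Kcube_subset_interior (d : ℕ) {s t : ℝ} (hst : s < t) :
    Kcube d s ⊆ interior (Kcube d t) := by
  have hopen : IsOpen {z : Euc d | ∀ i, z i ∈ Set.Ioo (-t) t} := by
    simp only [Set.ofPred_forall]
    exact isOpen_iInter_of_finite fun i => isOpen_Ioo.preimage (PiLp.continuous_apply 2 _ i)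
  have hsub : {z : Euc d | ∀ i, z i ∈ Set.Ioo (-t) t} ⊆ Kcube d t :=
    fun z hz i => Set.Ioo_subset_Icc_self (hz i)
  refine Set.Subset.trans ?_ (interior_maximal hsub hopen)
  exact fun z hz i => ⟨by linarith [(hz i).1], (hz i).2.trans_lt hst⟩

lemma mem_Kcube_of_dist_le {d : ℕ} {s r : ℝ} {x y : Euc d} (hx : x ∈ Kcube d s)
    (hxy : ‖x - y‖ ≤ r) : y ∈ Kcube d (s + r) := by
  intro i
  have h1 : |x i - y i| ≤ r := (PiLp.norm_apply_le (x - y) i).trans hxy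
  have h2 := abs_le.1 h1
  have h3 := hx i
  exact ⟨by linarith [h3.1, h2.2], by linarith [h3.2, h2.1]⟩

lemma two_mul_pow_sub_two_mul_pow_le {d : ℕ} (hd : 1 ≤ d) {R : ℝ} (hR : 1 ≤ R) :
    (2 * R) ^ d - (2 * (R - 1)) ^ d ≤ d * 2 ^ d * R ^ (d - 1) := by
  have hR0 : 0 < R := by linarith
  have hb : 1 + (d : ℝ) * (-(1 / R)) ≤ (1 + -(1 / R)) ^ d :=
    one_add_mul_le_pow (by
      have : 1 / R ≤ 1 := by rw [div_le_one hR0]; exact hR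
      linarith) d
  obtain ⟨n, rfl⟩ : ∃ n, d = n + 1 := ⟨d - 1, by omega⟩
  have h1 : R - 1 = R * (1 + -(1 / R)) := by field_simp; ring
  rw [h1, mul_pow, mul_pow, mul_pow, Nat.add_sub_cancel]
  have h2 := mul_le_mul_of_nonneg_left hb (by positivity : 0 ≤ (2 : ℝ) ^ (n + 1) * R ^ (n + 1))
  have h3 : (2 : ℝ) ^ (n + 1) * R ^ (n + 1) * (1 + ((n + 1 : ℕ) : ℝ) * (-(1 / R)))
      = 2 ^ (n + 1) * R ^ (n + 1) - ((n + 1 : ℕ) : ℝ) * 2 ^ (n + 1) * R ^ n := by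
    field_simp
    ring
  linarith

/-! ### A smooth cutoff equal to one on `K_{R-1}` and supported in `K_R` -/

lemma exists_lipschitzWith_smoothTransition : ∃ L : NNReal, LipschitzWith L smoothTransition := by
  have hd : Continuous (deriv smoothTransition) :=
    (smoothTransition.contDiff (n := 1)).continuous_deriv le_rfl
  have hsupp : HasCompactSupport (deriv smoothTransition) := by
    refine HasCompactSupport.intro (isCompact_Icc (a := (0 : ℝ)) (b := 1)) fun x hx => ?_
    rw [Set.mem_Icc, not_and_or, not_le, not_le] at hx
    rcases hx with hx | hx
    · have : IsLocalMin smoothTransition x := Filter.Eventually.of_forall fun y => by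
        rw [smoothTransition.zero_of_nonpos hx.le]; exact smoothTransition.nonneg y
      exact this.deriv_eq_zero
    · have : IsLocalMax smoothTransition x := Filter.Eventually.of_forall fun y => by
        rw [smoothTransition.one_of_one_le hx.le]; exact smoothTransition.le_one y
      exact this.deriv_eq_zero
  obtain ⟨M, hM⟩ := hsupp.exists_bound_of_continuous hd
  refine ⟨M.toNNReal, lipschitzWith_of_nnnorm_deriv_le
    (smoothTransition.contDiff (n := 1)).differentiable_one fun x => ?_⟩
  exact NNReal.coe_le_coe.1 ((hM x).trans (le_max_left _ _))

/-- A smooth cutoff between the cubes `K_{R-1}` and `K_R`. -/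
def cubeCutoff (d : ℕ) (R : ℝ) (x : Euc d) : ℝ :=
  ∏ i, smoothTransition (R - x i) * smoothTransition (R + x i)

lemma contDiff_cubeCutoff (d : ℕ) (R : ℝ) {n : ℕ∞} : ContDiff ℝ n (cubeCutoff d R) := by
  refine contDiff_prod fun i _ => ?_
  have hi : ContDiff ℝ n (fun x : Euc d => x i) := contDiff_piLp_apply 2
  exact (smoothTransition.contDiff.comp (contDiff_const.sub hi)).mul
    (smoothTransition.contDiff.comp (contDiff_const.add hi))

lemma cubeCutoff_nonneg (d : ℕ) (R : ℝ) (x : Euc d) : 0 ≤ cubeCutoff d R x :=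
  Finset.prod_nonneg fun _ _ => mul_nonneg (smoothTransition.nonneg _) (smoothTransition.nonneg _)

lemma cubeCutoff_le_one (d : ℕ) (R : ℝ) (x : Euc d) : cubeCutoff d R x ≤ 1 :=
  Finset.prod_le_one
    (fun _ _ => mul_nonneg (smoothTransition.nonneg _) (smoothTransition.nonneg _))
    fun _ _ => mul_le_one₀ (smoothTransition.le_one _) (smoothTransition.nonneg _)
      (smoothTransition.le_one _)

lemma cubeCutoff_eq_one {d : ℕ} {R : ℝ} {x : Euc d} (hx : x ∈ Kcube d (R - 1)) :
    cubeCutoff d R x = 1 := by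
  refine Finset.prod_eq_one fun i _ => ?_
  have := hx i
  rw [smoothTransition.one_of_one_le (by linarith [this.2]),
    smoothTransition.one_of_one_le (by linarith [this.1]), one_mul]

lemma cubeCutoff_eq_zero {d : ℕ} {R : ℝ} {x : Euc d} (hx : x ∉ Kcube d R) :
    cubeCutoff d R x = 0 := by
  simp only [Kcube, Set.mem_ofPred_eq, not_forall, Set.mem_Icc, not_and_or, not_le] at hx
  obtain ⟨i, hi | hi⟩ := hx
  · refine Finset.prod_eq_zero (Finset.mem_univ i) ?_
    rw [smoothTransition.zero_of_nonpos (x := R + x i) (by linarith), mul_zero]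
  · refine Finset.prod_eq_zero (Finset.mem_univ i) ?_
    rw [smoothTransition.zero_of_nonpos (x := R - x i) (by linarith), zero_mul]

lemma abs_prod_sub_prod_le {ι : Type*} (s : Finset ι) (a b : ι → ℝ)
    (ha : ∀ i, |a i| ≤ 1) (hb : ∀ i, |b i| ≤ 1) :
    |∏ i ∈ s, a i - ∏ i ∈ s, b i| ≤ ∑ i ∈ s, |a i - b i| := by
  induction s using Finset.induction_on with
  | empty => simp
  | insert j s hj ih =>
    rw [Finset.prod_insert hj, Finset.prod_insert hj, Finset.sum_insert hj]
    have hB : |∏ i ∈ s, b i| ≤ 1 := by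
      rw [Finset.abs_prod]
      exact Finset.prod_le_one (fun _ _ => abs_nonneg _) fun i _ => hb i
    calc |a j * ∏ i ∈ s, a i - b j * ∏ i ∈ s, b i|
        = |(a j - b j) * ∏ i ∈ s, b i + a j * (∏ i ∈ s, a i - ∏ i ∈ s, b i)| := by
          congr 1; ring
      _ ≤ |a j - b j| * |∏ i ∈ s, b i| + |a j| * |∏ i ∈ s, a i - ∏ i ∈ s, b i| := by
          rw [← abs_mul, ← abs_mul]; exact abs_add_le _ _
      _ ≤ |a j - b j| * 1 + 1 * ∑ i ∈ s, |a i - b i| := by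
          gcongr
          exact ha j
      _ = _ := by ring

lemma lipschitzWith_cubeCutoff {L : NNReal} (hL : LipschitzWith L smoothTransition)
    (d : ℕ) (R : ℝ) : LipschitzWith (d * (2 * L)) (cubeCutoff d R) := by
  have habs : ∀ t, |smoothTransition t| ≤ 1 := fun t => by
    rw [abs_of_nonneg (smoothTransition.nonneg t)]; exact smoothTransition.le_one t
  have hLs : ∀ s t, |smoothTransition s - smoothTransition t| ≤ L * |s - t| := fun s t => by
    simpa [Real.dist_eq] using hL.dist_le_mul s t
  refine LipschitzWith.of_dist_le_mul fun x y => ?_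
  rw [Real.dist_eq]
  have hone : ∀ (z : Euc d) (i : Fin d),
      |smoothTransition (R - z i) * smoothTransition (R + z i)| ≤ 1 := fun z i => by
    rw [abs_mul]
    exact mul_le_one₀ (habs _) (abs_nonneg _) (habs _)
  refine (abs_prod_sub_prod_le Finset.univ _ _ (hone x) (hone y)).trans ?_
  have hi : ∀ i ∈ (Finset.univ : Finset (Fin d)),
      |smoothTransition (R - x i) * smoothTransition (R + x i)
        - smoothTransition (R - y i) * smoothTransition (R + y i)| ≤ 2 * L * dist x y := by
    intro i _
    have hxy : |x i - y i| ≤ dist x y := by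
      rw [dist_eq_norm]; exact PiLp.norm_apply_le (x - y) i
    have h1 := hLs (R - x i) (R - y i)
    have h2 := hLs (R + x i) (R + y i)
    rw [show R - x i - (R - y i) = -(x i - y i) by ring, abs_neg] at h1
    rw [show R + x i - (R + y i) = x i - y i by ring] at h2
    have h3 : (L : ℝ) * |x i - y i| ≤ L * dist x y := by gcongr
    have h4 := abs_prod_sub_prod_le (Finset.univ : Finset (Fin 2))
      ![smoothTransition (R - x i), smoothTransition (R + x i)]
      ![smoothTransition (R - y i), smoothTransition (R + y i)]
      (by simp [Fin.forall_fin_two, habs]) (by simp [Fin.forall_fin_two, habs])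
    simp only [Fin.prod_univ_two, Fin.sum_univ_two, Matrix.cons_val_zero, Matrix.cons_val_one] at h4
    linarith
  refine (Finset.sum_le_card_nsmul _ _ _ hi).trans_eq ?_
  simp [mul_assoc]

lemma norm_gradient_eq {d : ℕ} (f : Euc d → ℝ) (x : Euc d) : ‖gradient f x‖ = ‖fderiv ℝ f x‖ := by
  simp [gradient]

lemma gradient_cubeCutoff_eq_zero {d : ℕ} {R : ℝ} {x : Euc d}
    (hx : x ∉ Kcube d R \ Kcube d (R - 1)) : gradient (cubeCutoff d R) x = 0 := by
  have h0 : fderiv ℝ (cubeCutoff d R) x = 0 := by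
    by_cases h1 : x ∈ Kcube d (R - 1)
    · refine IsLocalMax.fderiv_eq_zero (Filter.Eventually.of_forall fun y => ?_)
      rw [cubeCutoff_eq_one h1]; exact cubeCutoff_le_one d R y
    · have h2 : x ∉ Kcube d R := fun h => hx ⟨h, h1⟩
      refine IsLocalMin.fderiv_eq_zero (Filter.Eventually.of_forall fun y => ?_)
      rw [cubeCutoff_eq_zero h2]; exact cubeCutoff_nonneg d R y
  rw [gradient, h0, map_zero]

lemma tsupport_cubeCutoff_subset (d : ℕ) (R : ℝ) : tsupport (cubeCutoff d R) ⊆ Kcube d R :=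
  closure_minimal (fun _ hx => by_contra fun h => hx (cubeCutoff_eq_zero h))
    (isCompact_Kcube d R).isClosed

lemma hasCompactSupport_cubeCutoff (d : ℕ) (R : ℝ) : HasCompactSupport (cubeCutoff d R) :=
  HasCompactSupport.intro (isCompact_Kcube d R) fun _ hx => cubeCutoff_eq_zero hx

lemma integral_cubeCutoff_le (d : ℕ) {R : ℝ} (hR : 0 ≤ R) :
    ∫ x, cubeCutoff d R x ≤ (2 * R) ^ d := by
  have hm := (isCompact_Kcube d R).measurableSet
  rw [← volume_real_Kcube d hR, ← integral_indicator_one hm]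
  refine integral_mono ((contDiff_cubeCutoff d R (n := 0)).continuous.integrable_of_hasCompactSupport
    (hasCompactSupport_cubeCutoff d R))
    ((integrable_indicator_iff hm).2 (integrableOn_const (isCompact_Kcube d R).measure_ne_top))
    fun x => ?_
  by_cases hx : x ∈ Kcube d R
  · simpa [hx] using cubeCutoff_le_one d R x
  · simp [hx, cubeCutoff_eq_zero hx]

lemma le_integral_cubeCutoff (d : ℕ) {R : ℝ} (hR : 1 ≤ R) :
    (2 * (R - 1)) ^ d ≤ ∫ x, cubeCutoff d R x := by
  have hm := (isCompact_Kcube d (R - 1)).measurableSet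
  rw [← volume_real_Kcube d (by linarith : 0 ≤ R - 1), ← integral_indicator_one hm]
  refine integral_mono
    ((integrable_indicator_iff hm).2 (integrableOn_const (isCompact_Kcube d _).measure_ne_top))
    ((contDiff_cubeCutoff d R (n := 0)).continuous.integrable_of_hasCompactSupport
      (hasCompactSupport_cubeCutoff d R)) fun x => ?_
  by_cases hx : x ∈ Kcube d (R - 1)
  · simp [hx, cubeCutoff_eq_one hx]
  · simpa [hx] using cubeCutoff_nonneg d R x

lemma continuousOn_gradient {d : ℕ} {f : Euc d → ℝ} {U : Set (Euc d)} (hU : IsOpen U)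
    (hf : ContDiffOn ℝ 1 f U) : ContinuousOn (gradient f) U :=
  (InnerProductSpace.toDual ℝ (Euc d)).symm.continuous.comp_continuousOn
    (hf.continuousOn_fderiv_of_isOpen hU le_rfl)

lemma setIntegral_norm_gradient_cubeCutoff_sq_le {L : NNReal}
    (hL : LipschitzWith L smoothTransition) {d : ℕ} (hd : 1 ≤ d) {R : ℝ} (hR : 1 ≤ R) :
    ∫ x in Kcube d R, ‖gradient (cubeCutoff d R) x‖ ^ 2
      ≤ (d * (2 * L)) ^ 2 * (d * 2 ^ d * R ^ (d - 1)) := by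
  have hsub : Kcube d (R - 1) ⊆ Kcube d R := Kcube_mono d (by linarith)
  have hm := (isCompact_Kcube d (R - 1)).measurableSet
  have hvol : (volume : Measure (Euc d)).real (Kcube d R \ Kcube d (R - 1))
      ≤ d * 2 ^ d * R ^ (d - 1) := by
    rw [measureReal_sdiff hsub hm (isCompact_Kcube d _).measure_ne_top,
      volume_real_Kcube d (by linarith), volume_real_Kcube d (by linarith)]
    exact two_mul_pow_sub_two_mul_pow_le hd hR
  have heq : ∫ x in Kcube d R, ‖gradient (cubeCutoff d R) x‖ ^ 2
      = ∫ x in Kcube d R \ Kcube d (R - 1), ‖gradient (cubeCutoff d R) x‖ ^ 2 := by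
    refine setIntegral_eq_of_subset_of_forall_sdiff_eq_zero (isCompact_Kcube d R).measurableSet
      Set.sdiff_subset fun x hx => ?_
    rw [gradient_cubeCutoff_eq_zero hx.2]; simp
  rw [heq]
  have hb : ∀ x, ‖gradient (cubeCutoff d R) x‖ ^ 2 ≤ (d * (2 * L) : ℝ) ^ 2 := fun x => by
    rw [norm_gradient_eq]
    have := norm_fderiv_le_of_lipschitz ℝ (x₀ := x) (lipschitzWith_cubeCutoff hL d R)
    push_cast at this
    gcongr
  have hfin : volume (Kcube d R \ Kcube d (R - 1)) < ⊤ :=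
    (measure_mono Set.sdiff_subset).trans_lt (isCompact_Kcube d R).measure_lt_top
  refine (Real.le_norm_self _).trans ((norm_setIntegral_le_of_norm_le_const hfin fun x _ => ?_).trans
    (mul_le_mul_of_nonneg_left hvol (by positivity)))
  rw [Real.norm_of_nonneg (by positivity)]
  exact hb x

/-- Cauchy–Schwarz for continuous vector fields on a compact set. -/
lemma abs_setIntegral_inner_le {d : ℕ} {K : Set (Euc d)} (hK : IsCompact K)
    {u v : Euc d → Euc d} (hu : ContinuousOn u K) (hv : ContinuousOn v K) :
    |∫ x in K, ⟪u x, v x⟫| ≤ √(∫ x in K, ‖u x‖ ^ 2) * √(∫ x in K, ‖v x‖ ^ 2) := by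
  have hmem : ∀ {w : Euc d → Euc d}, ContinuousOn w K →
      MemLp (fun x => ‖w x‖) (ENNReal.ofReal 2) (volume.restrict K) := fun {w} hw => by
    obtain ⟨M, hM⟩ := hK.exists_bound_of_continuousOn hw
    have : IsFiniteMeasure (volume.restrict K) := ⟨by simpa using hK.measure_lt_top⟩
    refine MemLp.of_bound (hw.norm.aestronglyMeasurable hK.measurableSet) M ?_
    filter_upwards [ae_restrict_mem hK.measurableSet] with x hx
    simpa using hM x hx
  have hCS := integral_mul_le_Lp_mul_Lq_of_nonneg Real.HolderConjugate.two_two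
    (Filter.Eventually.of_forall fun x => norm_nonneg (u x))
    (Filter.Eventually.of_forall fun x => norm_nonneg (v x)) (hmem hu) (hmem hv)
  simp only [Real.rpow_two, ← Real.sqrt_eq_rpow] at hCS
  refine le_trans ?_ hCS
  refine (Real.norm_eq_abs _).symm.trans_le ((norm_integral_le_integral_norm _).trans ?_)
  refine integral_mono_of_nonneg (Filter.Eventually.of_forall fun x => norm_nonneg _)
    ((hu.norm.mul hv.norm).integrableOn_compact hK)
    (Filter.Eventually.of_forall fun x => norm_inner_le_norm _ _)

/-! ### The smeared charges -/

lemma cConst_pos {d : ℕ} (hd : 2 ≤ d) : 0 < cConst d := by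
  unfold cConst
  split_ifs with h
  · positivity
  · have h3 : (3 : ℝ) ≤ d := by exact_mod_cast (by omega : 3 ≤ d)
    have hv : 0 < (volume (ball (0 : Euc d) 1)).toReal :=
      ENNReal.toReal_pos (measure_ball_pos _ _ one_pos).ne' measure_ball_lt_top.ne
    exact mul_pos (mul_pos (by linarith) (by linarith)) hv

section Smear

variable {d : ℕ} {ρ : Euc d → ℝ} {η : ℝ}

lemma smear_nonneg (hρ : ∀ x, 0 ≤ ρ x) (hη : 0 < η) (p x : Euc d) : 0 ≤ smear d ρ η p x :=
  mul_nonneg (by positivity) (hρ _)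

lemma integrable_smear (hρ : Integrable ρ) (hη : 0 < η) (p : Euc d) :
    Integrable (smear d ρ η p) :=
  ((hρ.comp_smul (inv_ne_zero hη.ne')).comp_sub_right p).const_mul _

lemma integral_smear (hρ : ∫ x, ρ x = 1) (hη : 0 < η) (p : Euc d) :
    ∫ x, smear d ρ η p x = 1 := by
  unfold smear
  rw [integral_const_mul, integral_sub_right_eq_self (fun x => ρ (η⁻¹ • x)) p,
    Measure.integral_comp_smul, hρ]
  have : 0 < η ^ d := by positivity
  simp only [finrank_euclideanSpace, Fintype.card_fin, inv_pow, inv_inv, smul_eq_mul, mul_one]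
  rw [abs_of_pos this, inv_mul_cancel₀ this.ne']

lemma smear_eq_zero (hρ : Function.support ρ ⊆ closedBall 0 1) (hη : 0 < η) {p x : Euc d}
    (hx : η < ‖x - p‖) : smear d ρ η p x = 0 := by
  have h0 : ρ (η⁻¹ • (x - p)) = 0 := by
    by_contra h
    have := hρ h
    rw [mem_closedBall_zero_iff, norm_smul, norm_inv, Real.norm_of_nonneg hη.le,
      inv_mul_le_iff₀ hη, mul_one] at this
    linarith
  rw [smear, h0, mul_zero]

end Smear

/-- **Charge counting via the smeared electric field.** If `h` solves
`−Δh = c_d(Σ_{p∈Λ} N_p δ_p^{(η)} − m)` weakly inside `K_{R+2}` and is `C¹` on an open set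
containing `K_{R+2}`, then, with `C` depending only on `d`:
`Σ_{p∈Λ∩K_{R−2}} N_p ≤ m(2R)^d + C R^{(d−1)/2} ‖∇h‖_{L²(K_R)}` and
`Σ_{p∈Λ∩K_{R+1}} N_p ≥ m(2(R−1))^d − C R^{(d−1)/2} ‖∇h‖_{L²(K_R)}`. -/
theorem charge_counting
    (d : ℕ) (hd : 2 ≤ d)
    -- the fixed radial smearing function ρ
    (ρ : Euc d → ℝ) (hρmeas : Measurable ρ) (hρnonneg : ∀ x, 0 ≤ ρ x)
    (hρradial : ∀ x y : Euc d, ‖x‖ = ‖y‖ → ρ x = ρ y)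
    (hρsupp : Function.support ρ ⊆ closedBall 0 1)
    (hρint : ∫ x, ρ x = 1) :
    ∃ C : ℝ, 0 < C ∧
      ∀ (m : ℝ), 0 < m →
      ∀ (η R : ℝ), 0 < η → η ≤ 1 → 3 ≤ R →
      ∀ (Λ : Finset (Euc d)) (N : Euc d → ℕ), (∀ p ∈ Λ, 1 ≤ N p) →
      ∀ (Ω : Set (Euc d)), IsOpen Ω → Kcube d (R + 2) ⊆ Ω →
      ∀ (h : Euc d → ℝ), ContDiffOn ℝ 1 h Ω →
        (∀ φ : Euc d → ℝ, ContDiff ℝ (⊤ : ℕ∞) φ → HasCompactSupport φ →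
          tsupport φ ⊆ interior (Kcube d (R + 2)) →
          ∫ x, ⟪gradient h x, gradient φ x⟫ =
            cConst d * ((∑ p ∈ Λ, (N p : ℝ) * ∫ x, smear d ρ η p x * φ x) - m * ∫ x, φ x)) →
        (∑ p ∈ Λ.filter (fun p => p ∈ Kcube d (R - 2)), (N p : ℝ))
            ≤ m * (2 * R) ^ d
              + C * R ^ (((d : ℝ) - 1) / 2) *
                  Real.sqrt (∫ x in Kcube d R, ‖gradient h x‖ ^ 2)
        ∧ m * (2 * (R - 1)) ^ d
              - C * R ^ (((d : ℝ) - 1) / 2) *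
                  Real.sqrt (∫ x in Kcube d R, ‖gradient h x‖ ^ 2)
            ≤ ∑ p ∈ Λ.filter (fun p => p ∈ Kcube d (R + 1)), (N p : ℝ) := by
  obtain ⟨L, hL⟩ := exists_lipschitzWith_smoothTransition
  have hc := cConst_pos hd
  have hρi : Integrable ρ := by
    by_contra h
    rw [integral_undef h] at hρint
    exact zero_ne_one hρint
  set C₀ : ℝ := d * (2 * L) * √(d * 2 ^ d) with hC₀
  have hC₀' : 0 ≤ C₀ := by positivity
  refine ⟨C₀ / cConst d + 1, by positivity, ?_⟩
  intro m hm η R hη hη1 hR Λ N _ Ω hΩ hKΩ h hh hweak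
  have hKR : Kcube d R ⊆ Ω := (Kcube_mono d (by linarith)).trans hKΩ
  have hw := hweak (cubeCutoff d R) (contDiff_cubeCutoff d R) (hasCompactSupport_cubeCutoff d R)
    ((tsupport_cubeCutoff_subset d R).trans (Kcube_subset_interior d (by linarith)))
  set E : ℝ := √(∫ x in Kcube d R, ‖gradient h x‖ ^ 2) with hE
  set P : ℝ := R ^ (((d : ℝ) - 1) / 2) with hP
  have hR0 : 0 < R := by linarith
  have hP0 : 0 < P := Real.rpow_pos_of_pos hR0 _
  have hsqrtP : √(R ^ (d - 1)) = P := by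
    rw [hP, Real.sqrt_eq_rpow, ← Real.rpow_natCast, ← Real.rpow_mul hR0.le,
      Nat.cast_sub (by omega)]
    congr 1
    push_cast
    ring
  have hflux : |∫ x, ⟪gradient h x, gradient (cubeCutoff d R) x⟫| ≤ C₀ * P * E := by
    rw [← setIntegral_eq_integral_of_forall_compl_eq_zero (s := Kcube d R) fun x hx => by
      rw [gradient_cubeCutoff_eq_zero fun h' => hx h'.1, inner_zero_right]]
    refine (abs_setIntegral_inner_le (isCompact_Kcube d R)
      ((continuousOn_gradient hΩ hh).mono hKR)
      ((continuousOn_gradient isOpen_univ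
        (contDiff_cubeCutoff d R (n := 1)).contDiffOn).mono (Set.subset_univ _))).trans ?_
    rw [mul_comm]
    refine mul_le_mul_of_nonneg_right ?_ (Real.sqrt_nonneg _)
    refine (Real.sqrt_le_sqrt (setIntegral_norm_gradient_cubeCutoff_sq_le hL (by omega)
      (by linarith))).trans_eq ?_
    rw [Real.sqrt_mul (by positivity), Real.sqrt_sq (by positivity),
      Real.sqrt_mul (by positivity), hsqrtP, hC₀, ← mul_assoc]
  set S : ℝ := ∑ p ∈ Λ, (N p : ℝ) * ∫ x, smear d ρ η p x * cubeCutoff d R x with hS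
  have hSeq : |S - m * ∫ x, cubeCutoff d R x| ≤ (C₀ / cConst d + 1) * P * E := by
    rw [hw, abs_mul, abs_of_pos hc, mul_comm, ← le_div_iff₀ hc] at hflux
    refine hflux.trans ?_
    have : 0 ≤ P * E := mul_nonneg hP0.le (Real.sqrt_nonneg _)
    have h2 : C₀ * P * E / cConst d = C₀ / cConst d * P * E := by ring
    nlinarith
  have hSlo := (abs_le.1 hSeq).1
  have hShi := (abs_le.1 hSeq).2
  have hint : ∀ p, Integrable fun x => smear d ρ η p x * cubeCutoff d R x := fun p => by
    refine (integrable_smear hρi hη p).mul_bdd (c := 1)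
      (contDiff_cubeCutoff d R (n := 0)).continuous.aestronglyMeasurable
      (Filter.Eventually.of_forall fun x => ?_)
    rw [Real.norm_of_nonneg (cubeCutoff_nonneg d R x)]
    exact cubeCutoff_le_one d R x
  have hnn : ∀ p, 0 ≤ ∫ x, smear d ρ η p x * cubeCutoff d R x := fun p =>
    integral_nonneg fun x => mul_nonneg (smear_nonneg hρnonneg hη p x) (cubeCutoff_nonneg d R x)
  have hle : ∀ p, ∫ x, smear d ρ η p x * cubeCutoff d R x ≤ 1 := fun p => by
    rw [← integral_smear hρint hη p]
    exact integral_mono (hint p) (integrable_smear hρi hη p) fun x =>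
      mul_le_of_le_one_right (smear_nonneg hρnonneg hη p x) (cubeCutoff_le_one d R x)
  have hin : ∀ p ∈ Kcube d (R - 2), ∫ x, smear d ρ η p x * cubeCutoff d R x = 1 := by
    intro p hp
    rw [← integral_smear hρint hη p]
    congr 1 with x
    by_cases hx : η < ‖x - p‖
    · rw [smear_eq_zero hρsupp hη hx, zero_mul]
    · have hxp : ‖p - x‖ ≤ 1 := by rw [norm_sub_rev]; linarith
      have := mem_Kcube_of_dist_le hp hxp
      rw [show R - 2 + 1 = R - 1 by ring] at this
      rw [cubeCutoff_eq_one this, mul_one]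
  have hout : ∀ p, p ∉ Kcube d (R + 1) → ∫ x, smear d ρ η p x * cubeCutoff d R x = 0 := by
    intro p hp
    refine integral_eq_zero_of_ae (Filter.Eventually.of_forall fun x => ?_)
    by_cases hx : η < ‖x - p‖
    · simp [smear_eq_zero hρsupp hη hx]
    · have hxK : x ∉ Kcube d R := fun hxK => hp (mem_Kcube_of_dist_le hxK (by linarith))
      simp [cubeCutoff_eq_zero hxK]
  constructor
  · have h1 : ∑ p ∈ Λ.filter (fun p => p ∈ Kcube d (R - 2)), (N p : ℝ) ≤ S := by
      rw [Finset.sum_filter]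
      refine Finset.sum_le_sum fun p _ => ?_
      split_ifs with hp
      · rw [hin p hp, mul_one]
      · exact mul_nonneg (Nat.cast_nonneg _) (hnn p)
    have h2 := mul_le_mul_of_nonneg_left (integral_cubeCutoff_le d hR0.le) hm.le
    linarith
  · have h1 : S ≤ ∑ p ∈ Λ.filter (fun p => p ∈ Kcube d (R + 1)), (N p : ℝ) := by
      rw [Finset.sum_filter]
      refine Finset.sum_le_sum fun p _ => ?_
      split_ifs with hp
      · exact mul_le_of_le_one_right (Nat.cast_nonneg _) (hle p)
      · rw [hout p hp, mul_zero]
    have h2 := mul_le_mul_of_nonneg_left (le_integral_cubeCutoff d (by linarith : 1 ≤ R)) hm.le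
    linarith
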